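/- arXiv:math/9809104 — 2 statements merged into one kernel-verified Lean document; each statement's English description precedes it below -/
import Mathlib

section
/- Let f be an A-valued 4-cocycle on the abelian group B. For each fixed w ∈ B, the map ψ_w : B³ → A defined by ψ_w(x,y,z) := f(x,y,z,w)·f(x,w,y,z)·(f(x,y,w,z)·f(w,x,y,z))⁻¹ (the signed shuffle of w through the ordered triple (x,y,z)) is an A-valued 3-cocycle on B: ψ_w(y,z,v)·ψ_w(x,y+z,v)·ψ_w(x,y,z) = ψ_w(x+y,z,v)·ψ_w(x,y,z+v) for all x,y,z,v ∈ B. -/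
/-- An `A`-valued 4-cocycle on the abelian group `B` (with `A` a trivial `B`-module). -/
def IsFourCocycle {B A : Type*} [AddCommGroup B] [CommGroup A]
    (f : B → B → B → B → A) : Prop :=
  ∀ x y z w v : B,
    f y z w v * f x (y + z) w v * f x y z (w + v)
      = f (x + y) z w v * f x y (z + w) v * f x y z w

/-- An `A`-valued 3-cocycle on the abelian group `B`. -/
def IsThreeCocycle {B A : Type*} [AddCommGroup B] [CommGroup A]
    (ψ : B → B → B → A) : Prop :=
  ∀ x y z w : B, ψ y z w * ψ x (y + z) w * ψ x y z = ψ (x + y) z w * ψ x y (z + w)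

/-- The signed shuffle `ψ_w(x,y,z)` of the last variable `w` through the triple `(x,y,z)`. -/
def psiShuffle {B A : Type*} [AddCommGroup B] [CommGroup A]
    (f : B → B → B → B → A) (w x y z : B) : A :=
  f x y z w * f x w y z * (f x y w z * f w x y z)⁻¹

/-- The signed shuffle `φ_a(y,z,w)` of the first variable `a` through the triple `(y,z,w)`. -/
def phiShuffle {B A : Type*} [AddCommGroup B] [CommGroup A]
    (f : B → B → B → B → A) (a y z w : B) : A :=
  f y a z w * f y z w a * (f a y z w * f y z a w)⁻¹

/-- For a 4-cocycle `f` and each fixed `w`, the signed shuffle `ψ_w` is a 3-cocycle. -/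
theorem psiShuffle_is_three_cocycle {B A : Type*} [AddCommGroup B] [CommGroup A]
    (f : B → B → B → B → A) (hf : IsFourCocycle f) (w : B) :
    IsThreeCocycle (psiShuffle f w) := by
  intro x y z v
  -- pass to additive notation in the coefficient group
  let g : B → B → B → B → Additive A := fun a b c d => Additive.ofMul (f a b c d)
  have hg : ∀ a b c d e : B, g b c d e + g a (b + c) d e + g a b c (d + e)
      = g (a + b) c d e + g a b (c + d) e + g a b c d := fun a b c d e => hf a b c d e
  have h1 := hg x y z v w
  have h2 := hg x y z w v
  have h3 := hg x y w z v
  have h4 := hg x w y z v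
  have h5 := hg w x y z v
  rw [add_comm v w] at h1
  rw [add_comm w z] at h3
  rw [add_comm w y] at h4
  rw [add_comm w x] at h5
  let p : B → B → B → Additive A := fun a b c =>
    g a b c w + g a w b c + -(g a b w c + g w a b c)
  change p y z v + p x (y + z) v + p x y z = p (x + y) z v + p x y (z + v)
  simp only [p]
  clear_value g
  rw [← sub_eq_zero] at h1 h2 h3 h4 h5 ⊢
  have key := congrArg₂ (· + ·) (congrArg₂ (· - ·) (congrArg₂ (· + ·) (congrArg₂ (· - ·) h1 h2) h3) h4) h5
  simp only [sub_zero, add_zero] at key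
  rw [← key]
  abel
end

section
/- Let f be an A-valued 4-cocycle on the abelian group B. For each fixed a ∈ B, the map φ_a : B³ → A defined by φ_a(y,z,w) := f(y,a,z,w)·f(y,z,w,a)·(f(a,y,z,w)·f(y,z,a,w))⁻¹ (the signed shuffle of a through the ordered triple (y,z,w)) is an A-valued 3-cocycle on B: φ_a(z,w,v)·φ_a(y,z+w,v)·φ_a(y,z,w) = φ_a(y+z,w,v)·φ_a(y,z,w+v) for all y,z,w,v ∈ B. -/
/-- For a 4-cocycle `f` and each fixed `a`, the signed shuffle `φ_a` is a 3-cocycle. -/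
theorem phiShuffle_is_three_cocycle {B A : Type*} [AddCommGroup B] [CommGroup A]
    (f : B → B → B → B → A) (hf : IsFourCocycle f) (a : B) :
    IsThreeCocycle (phiShuffle f a) := by
  -- alternating sum of the cocycle identity over the five positions of `a`
  intro x y z w
  have key : ∀ x y z w v : B,
      Additive.ofMul (f y z w v) + Additive.ofMul (f x (y + z) w v)
        + Additive.ofMul (f x y z (w + v))
      = Additive.ofMul (f (x + y) z w v) + Additive.ofMul (f x y (z + w) v)
        + Additive.ofMul (f x y z w) := fun x y z w v =>
    congrArg Additive.ofMul (hf x y z w v)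
  have h1 := key a x y z w
  have h2 := key x a y z w
  have h3 := key x y a z w
  have h4 := key x y z a w
  have h5 := key x y z w a
  rw [add_comm a x] at h1
  rw [add_comm a y] at h2
  rw [add_comm a z] at h3
  rw [add_comm a w] at h4
  apply Additive.ofMul.injective
  simp only [phiShuffle, ofMul_mul, ofMul_inv]
  rw [← sub_eq_zero] at h1 h2 h3 h4 h5 ⊢
  have h := congrArg₂ (· + ·) (congrArg₂ (· - ·) (congrArg₂ (· + ·)
    (congrArg₂ (· - ·) h1 h2) h3) h4) h5
  simp only [sub_zero, add_zero] at h
  rw [← h]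
  abel
end
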